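/- If 2 is invertible in the ring with involution A, then Q̂^n(C) = 0 for every finite-dimensional A-module chain complex C and every n ∈ ℤ; that is, every n-dimensional hyperquadratic structure on C is equivalent to 0. -/

import Mathlib

noncomputable section
open scoped Classical

/-- The sign `(-1)^k` for `k : ℤ`. -/
def esign (k : ℤ) : ℤ := (((-1 : ℤˣ) ^ k : ℤˣ) : ℤ)

variable {A : Type} [Ring A] [StarRing A]

/-- The dual of a left `A`-module, made into a left `A`-module using the involution:
`(a • f) x = f x * star a`. -/
abbrev SDual (A : Type) [Ring A] [StarRing A] (M : Type) [AddCommGroup M] [Module A M] : Type :=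
  M →ₗ[A] A

section SDualBasics

variable {M N : Type} [AddCommGroup M] [Module A M] [AddCommGroup N] [Module A N]

instance SDual.instSMul : SMul A (SDual A M) where
  smul a f :=
    { toFun := fun x => f x * star a
      map_add' := fun x y => by simp [add_mul]
      map_smul' := fun c x => by simp [mul_assoc] }

@[simp] theorem SDual.smul_apply (a : A) (f : SDual A M) (x : M) :
    (a • f) x = f x * star a := rfl

instance SDual.instModule : Module A (SDual A M) :=
  Module.ofMinimalAxioms
    (fun a f g => by ext x; simp [add_mul])
    (fun a b f => by ext x; simp [star_add, mul_add])
    (fun a b f => by ext x; simp [star_mul, mul_assoc])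
    (fun f => by ext x; simp)

/-- The dual of an `A`-linear map. -/
def sdualMap (f : M →ₗ[A] N) : SDual A N →ₗ[A] SDual A M where
  toFun g := g.comp f
  map_add' g h := rfl
  map_smul' a g := rfl

@[simp] theorem sdualMap_apply (f : M →ₗ[A] N) (g : SDual A N) (x : M) :
    sdualMap f g x = g (f x) := rfl

/-- The canonical evaluation map `M → M**`, `x ↦ (f ↦ star (f x))`. -/
def sdualEval (A : Type) [Ring A] [StarRing A] (M : Type) [AddCommGroup M] [Module A M] :
    M →ₗ[A] SDual A (SDual A M) where
  toFun x :=
    { toFun := fun f => star (f x)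
      map_add' := fun f g => by simp [star_add]
      map_smul' := fun a f => by simp [star_mul] }
  map_add' x y := by ext f; simp [star_add]
  map_smul' a x := by ext f; simp [star_mul]

end SDualBasics

/-- The underlying graded modules of a chain complex. -/
structure PreCx (A : Type) [Ring A] [StarRing A] : Type 1 where
  Mod : ℤ → Type
  acg : ∀ r, AddCommGroup (Mod r)
  mod : ∀ r, letI := acg r; Module A (Mod r)

attribute [instance] PreCx.acg PreCx.mod

/-- A finite-dimensional chain complex of f.g. projective left `A`-modules,
together with (the automatically satisfied) reflexivity of the double duality map. -/
structure ChainCx (A : Type) [Ring A] [StarRing A] extends PreCx A : Type 1 where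
  fg : ∀ r, Module.Finite A (Mod r)
  proj : ∀ r, Module.Projective A (Mod r)
  bdd : ∃ N : ℕ, ∀ r : ℤ, (N : ℤ) < |r| → Subsingleton (Mod r)
  d : ∀ r, Mod (r + 1) →ₗ[A] Mod r
  dd : ∀ r, (d r).comp (d (r + 1)) = 0
  refl : ∀ r, Function.Bijective (sdualEval A (Mod r))

namespace ChainCx

variable (C : ChainCx A)

/-- Transport along an equality of degrees. -/
def cst : ∀ {r r' : ℤ}, r = r' → (C.Mod r →ₗ[A] C.Mod r')
  | _, _, rfl => LinearMap.id

/-- Transport of duals along an equality of degrees. -/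
def dcst {r r' : ℤ} (h : r = r') : SDual A (C.Mod r) →ₗ[A] SDual A (C.Mod r') :=
  sdualMap (C.cst h.symm)

/-- The inverse of the double duality map. -/
def coev (r : ℤ) : SDual A (SDual A (C.Mod r)) →ₗ[A] C.Mod r :=
  (LinearEquiv.ofBijective (sdualEval A (C.Mod r)) (C.refl r)).symm.toLinearMap

/-- The transposition `T` on maps `C^p → C_q`, using the identification `M** = M`. -/
def T (p q : ℤ) (θ : SDual A (C.Mod p) →ₗ[A] C.Mod q) :
    SDual A (C.Mod q) →ₗ[A] C.Mod p :=
  esign (p * q) • ((C.coev p).comp (sdualMap θ))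

/-- The transposition `T` on maps `C_p → C^q`, using the identification `M** = M`. -/
def Tb (p q : ℤ) (θ : C.Mod p →ₗ[A] SDual A (C.Mod q)) :
    C.Mod q →ₗ[A] SDual A (C.Mod p) :=
  esign (p * q) • ((sdualMap θ).comp (sdualEval A (C.Mod q)))

/-- The dual differential `C^a → C^b` (where `b = a + 1`). -/
def dstarTo {a b : ℤ} (h : b = a + 1) : SDual A (C.Mod a) →ₗ[A] SDual A (C.Mod b) :=
  sdualMap ((C.d a).comp (C.cst h))

end ChainCx

/-- The group of `n`-dimensional symmetric chains `{φ_s : C^{n-r+s} → C_r}`. -/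
abbrev SymCh (C : ChainCx A) (n : ℤ) : Type :=
  ∀ (s : ℕ) (r : ℤ), SDual A (C.Mod (n - r + (s : ℤ))) →ₗ[A] C.Mod r

/-- The group of `n`-dimensional quadratic chains `{ψ_s : C^{n-r-s} → C_r}`. -/
abbrev QuadCh (C : ChainCx A) (n : ℤ) : Type :=
  ∀ (s : ℕ) (r : ℤ), SDual A (C.Mod (n - r - (s : ℤ))) →ₗ[A] C.Mod r

/-- The group of `n`-dimensional hyperquadratic chains `{θ_s : C^{n-r+s} → C_r}, s ∈ ℤ`. -/
abbrev HypCh (C : ChainCx A) (n : ℤ) : Type :=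
  ∀ (s : ℤ) (r : ℤ), SDual A (C.Mod (n - r + s)) →ₗ[A] C.Mod r

variable (C : ChainCx A)

/-- Reindexing of symmetric chains along an equality of dimensions. -/
def symCastDim {n n' : ℤ} (h : n = n') (φ : SymCh C n) : SymCh C n' := fun s r =>
  (φ s r).comp (C.dcst (show n' - r + (s : ℤ) = n - r + (s : ℤ) by rw [h]))

/-- Reindexing of quadratic chains along an equality of dimensions. -/
def quadCastDim {n n' : ℤ} (h : n = n') (ψ : QuadCh C n) : QuadCh C n' := fun s r =>
  (ψ s r).comp (C.dcst (show n' - r - (s : ℤ) = n - r - (s : ℤ) by rw [h]))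

/-- Reindexing of hyperquadratic chains along an equality of dimensions. -/
def hypCastDim {n n' : ℤ} (h : n = n') (θ : HypCh C n) : HypCh C n' := fun s r =>
  (θ s r).comp (C.dcst (show n' - r + s = n - r + s by rw [h]))

/-- The boundary of an `(n+1)`-dimensional symmetric chain:
`(dξ)_s = d ξ_s + (-1)^r ξ_s d* + (-1)^{n+s} (ξ_{s-1} + (-1)^s T ξ_{s-1})`. -/
def symBnd (n : ℤ) (ξ : SymCh C (n + 1)) : SymCh C n
  | s, r =>
    (C.d r).comp ((ξ s (r + 1)).comp
        (C.dcst (show n - r + (s : ℤ) = n + 1 - (r + 1) + (s : ℤ) by ring)))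
    + esign r • ((ξ s r).comp
        (C.dstarTo (show n + 1 - r + (s : ℤ) = (n - r + (s : ℤ)) + 1 by ring)))
    + (match s with
      | 0 => 0
      | (t + 1) =>
        esign (n + 1 + t) • (
          (ξ t r).comp (C.dcst (show n - r + ((t + 1 : ℕ) : ℤ) = n + 1 - r + (t : ℤ) by
            push_cast; ring))
          + esign ((t : ℤ) + 1) •
            ((C.cst (show n + 1 - (n - r + ((t + 1 : ℕ) : ℤ)) + (t : ℤ) = r by push_cast; ring)).comp
              (C.T _ _ (ξ t (n - r + ((t + 1 : ℕ) : ℤ)))))))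

/-- The boundary of an `(n+1)`-dimensional quadratic chain:
`(dχ)_s = d χ_s + (-1)^r χ_s d* + (-1)^{n-s} (χ_{s+1} + (-1)^{s+1} T χ_{s+1})`. -/
def quadBnd (n : ℤ) (χ : QuadCh C (n + 1)) : QuadCh C n := fun s r =>
  (C.d r).comp ((χ s (r + 1)).comp
      (C.dcst (show n - r - (s : ℤ) = n + 1 - (r + 1) - (s : ℤ) by ring)))
  + esign r • ((χ s r).comp
      (C.dstarTo (show n + 1 - r - (s : ℤ) = (n - r - (s : ℤ)) + 1 by ring)))
  + esign (n - s) • (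
      (χ (s + 1) r).comp (C.dcst (show n - r - (s : ℤ) = n + 1 - r - ((s + 1 : ℕ) : ℤ) by
        push_cast; ring))
      + esign ((s : ℤ) + 1) •
        ((C.cst (show n + 1 - (n - r - (s : ℤ)) - ((s + 1 : ℕ) : ℤ) = r by push_cast; ring)).comp
          (C.T _ _ (χ (s + 1) (n - r - (s : ℤ))))))

/-- The boundary of an `(n+1)`-dimensional hyperquadratic chain. -/
def hypBnd (n : ℤ) (ν : HypCh C (n + 1)) : HypCh C n := fun s r =>
  (C.d r).comp ((ν s (r + 1)).comp
      (C.dcst (show n - r + s = n + 1 - (r + 1) + s by ring)))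
  + esign r • ((ν s r).comp
      (C.dstarTo (show n + 1 - r + s = (n - r + s) + 1 by ring)))
  + esign (n + s) • (
      (ν (s - 1) r).comp (C.dcst (show n - r + s = n + 1 - r + (s - 1) by ring))
      + esign s •
        ((C.cst (show n + 1 - (n - r + s) + (s - 1) = r by ring)).comp
          (C.T _ _ (ν (s - 1) (n - r + s)))))

/-- `φ` is an `n`-dimensional symmetric structure on `C`. -/
def IsSymStr (n : ℤ) (φ : SymCh C n) : Prop :=
  symBnd C (n - 1) (symCastDim C (show n = (n - 1) + 1 by ring) φ) = 0

/-- `ψ` is an `n`-dimensional quadratic structure on `C`. -/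
def IsQuadStr (n : ℤ) (ψ : QuadCh C n) : Prop :=
  quadBnd C (n - 1) (quadCastDim C (show n = (n - 1) + 1 by ring) ψ) = 0

/-- `θ` is an `n`-dimensional hyperquadratic structure on `C`. -/
def IsHypStr (n : ℤ) (θ : HypCh C n) : Prop :=
  hypBnd C (n - 1) (hypCastDim C (show n = (n - 1) + 1 by ring) θ) = 0

/-- The subgroup of `n`-dimensional symmetric structures (cycles). -/
def symCycles (n : ℤ) : AddSubgroup (SymCh C n) := AddSubgroup.closure {φ | IsSymStr C n φ}

/-- The subgroup of boundaries of symmetric chains. -/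
def symBdrys (n : ℤ) : AddSubgroup (SymCh C n) := AddSubgroup.closure (Set.range (symBnd C n))

/-- The symmetric `Q`-group `Q^n(C)`. -/
def Qsym (n : ℤ) : Type := symCycles C n ⧸ ((symBdrys C n).addSubgroupOf (symCycles C n))

instance (n : ℤ) : AddCommGroup (Qsym C n) :=
  inferInstanceAs (AddCommGroup (_ ⧸ (_ : AddSubgroup _)))

/-- The class of a symmetric structure in `Q^n(C)`. -/
def mkSym (n : ℤ) (φ : SymCh C n) (h : IsSymStr C n φ) : Qsym C n :=
  QuotientAddGroup.mk ⟨φ, AddSubgroup.subset_closure h⟩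

def quadCycles (n : ℤ) : AddSubgroup (QuadCh C n) := AddSubgroup.closure {ψ | IsQuadStr C n ψ}

def quadBdrys (n : ℤ) : AddSubgroup (QuadCh C n) := AddSubgroup.closure (Set.range (quadBnd C n))

/-- The quadratic `Q`-group `Q_n(C)`. -/
def Qquad (n : ℤ) : Type := quadCycles C n ⧸ ((quadBdrys C n).addSubgroupOf (quadCycles C n))

instance (n : ℤ) : AddCommGroup (Qquad C n) :=
  inferInstanceAs (AddCommGroup (_ ⧸ (_ : AddSubgroup _)))

def mkQuad (n : ℤ) (ψ : QuadCh C n) (h : IsQuadStr C n ψ) : Qquad C n :=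
  QuotientAddGroup.mk ⟨ψ, AddSubgroup.subset_closure h⟩

def hypCycles (n : ℤ) : AddSubgroup (HypCh C n) := AddSubgroup.closure {θ | IsHypStr C n θ}

def hypBdrys (n : ℤ) : AddSubgroup (HypCh C n) := AddSubgroup.closure (Set.range (hypBnd C n))

/-- The hyperquadratic `Q`-group `Q̂^n(C)`. -/
def Qhyp (n : ℤ) : Type := hypCycles C n ⧸ ((hypBdrys C n).addSubgroupOf (hypCycles C n))

instance (n : ℤ) : AddCommGroup (Qhyp C n) :=
  inferInstanceAs (AddCommGroup (_ ⧸ (_ : AddSubgroup _)))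

def mkHyp (n : ℤ) (θ : HypCh C n) (h : IsHypStr C n θ) : Qhyp C n :=
  QuotientAddGroup.mk ⟨θ, AddSubgroup.subset_closure h⟩

/-- The symmetrization `(1+T)ψ` of a quadratic chain. -/
def oneTchain (n : ℤ) (ψ : QuadCh C n) : SymCh C n
  | 0, r =>
    (ψ 0 r).comp (C.dcst (show n - r + ((0 : ℕ) : ℤ) = n - r - ((0 : ℕ) : ℤ) by push_cast; ring))
    + (C.cst (show n - (n - r + ((0 : ℕ) : ℤ)) - ((0 : ℕ) : ℤ) = r by push_cast; ring)).comp
        (C.T _ _ (ψ 0 (n - r + ((0 : ℕ) : ℤ))))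
  | (_ + 1), _ => 0

/-- The map `J` from symmetric to hyperquadratic chains. -/
def Jchain (n : ℤ) (φ : SymCh C n) : HypCh C n := fun s r =>
  if h : 0 ≤ s then
    (φ s.toNat r).comp (C.dcst (by rw [Int.toNat_of_nonneg h]))
  else 0

/-- The map `H` from hyperquadratic to quadratic chains, `ψ_s = θ_{-s-1}`. -/
def Hchain (n : ℤ) (θ : HypCh C n) : QuadCh C (n - 1) := fun s r =>
  (θ (-(s : ℤ) - 1) r).comp
    (C.dcst (show n - 1 - r - (s : ℤ) = n - r + (-(s : ℤ) - 1) by ring))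

theorem esign_add (a b : ℤ) : esign (a + b) = esign a * esign b := by
  simp [esign, zpow_add]

theorem esign_one : esign 1 = -1 := by
  simp [esign]

theorem esign_eq_one_or (a : ℤ) : esign a = 1 ∨ esign a = -1 := by
  rcases Int.units_eq_one_or ((-1 : ℤˣ) ^ a) with h | h <;> simp [esign, h]

/-- Two-divisibility of the group of linear maps when `2` is a unit. -/
theorem exists_add_self_eq {A M N : Type} [Ring A] [AddCommGroup M] [Module A M]
    [AddCommGroup N] [Module A N] (h2 : IsUnit (2 : A)) (f : M →ₗ[A] N) :
    ∃ g : M →ₗ[A] N, g + g = f := by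
  obtain ⟨u, hu⟩ := h2
  have hc : ∀ a : A, (↑u⁻¹ : A) * a = a * ↑u⁻¹ := fun a =>
    ((show Commute (u : A) a by rw [hu]; exact Commute.ofNat_left 2 a).units_inv_left).eq
  refine ⟨{ toFun := fun x => (↑u⁻¹ : A) • f x
            map_add' := fun x y => by simp
            map_smul' := fun a x => by simp [smul_smul, hc] }, ?_⟩
  ext x
  change (↑u⁻¹ : A) • f x + (↑u⁻¹ : A) • f x = f x
  rw [← smul_add, ← two_smul A (f x), ← hu, smul_smul, Units.inv_mul, one_smul]

/-- Absence of two-torsion in modules when `2` is a unit. -/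
theorem eq_of_add_self_eq {A N : Type} [Ring A] [AddCommGroup N] [Module A N]
    (h2 : IsUnit (2 : A)) {x y : N} (h : x + x = y + y) : x = y := by
  rw [← two_smul A x, ← two_smul A y] at h
  exact h2.smul_left_cancel.mp h

namespace ChainCx

theorem T_add (p q : ℤ) (f g : SDual A (C.Mod p) →ₗ[A] C.Mod q) :
    C.T p q (f + g) = C.T p q f + C.T p q g := by
  have h : sdualMap (f + g) = sdualMap f + sdualMap g := by
    ext x y
    simp
  rw [T, h, LinearMap.comp_add, smul_add]
  rfl

/-- The transposition as a homomorphism of additive groups. -/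
def THom (p q : ℤ) :
    (SDual A (C.Mod p) →ₗ[A] C.Mod q) →+ (SDual A (C.Mod q) →ₗ[A] C.Mod p) :=
  AddMonoidHom.mk' (C.T p q) (C.T_add p q)

theorem T_zsmul (p q k : ℤ) (f : SDual A (C.Mod p) →ₗ[A] C.Mod q) :
    C.T p q (k • f) = k • C.T p q f :=
  map_zsmul (C.THom p q) k f

theorem comp_zsmul {B L M N : Type} [Ring B] [AddCommGroup L] [Module B L] [AddCommGroup M]
    [Module B M] [AddCommGroup N] [Module B N] (k : ℤ) (g : M →ₗ[B] N) (f : L →ₗ[B] M) :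
    g.comp (k • f) = k • g.comp f :=
  LinearMap.ext fun x => map_zsmul g k (f x)

theorem cst_comp_T {a b : ℤ} (q : ℤ) (h : a = b) (f : SDual A (C.Mod a) →ₗ[A] C.Mod q) :
    (C.cst h).comp (C.T a q f) = C.T b q (f.comp (C.dcst h.symm)) := by
  subst h
  rfl

theorem dcst_comp_dstarTo {a b c : ℤ} (h : b = a + 1) (h' : b = c) :
    (C.dcst h').comp (C.dstarTo h) = C.dstarTo (h'.symm.trans h) := by
  subst h'
  rfl

/-- The component `θ_s : C^p → C_r` of a hyperquadratic chain, for any `p` equal to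
`n - r + s`. -/
def hypAt {n : ℤ} (θ : HypCh C n) (s r p : ℤ) (h : p = n - r + s) :
    SDual A (C.Mod p) →ₗ[A] C.Mod r :=
  (θ s r).comp (C.dcst h)

theorem hypAt_rfl {n : ℤ} (θ : HypCh C n) (s r : ℤ) :
    C.hypAt θ s r (n - r + s) rfl = θ s r :=
  rfl

theorem hypAt_hypCastDim {n n' : ℤ} (e : n = n') (θ : HypCh C n) (s r p : ℤ)
    (h : p = n' - r + s) :
    C.hypAt (hypCastDim C e θ) s r p h = C.hypAt θ s r p (by rw [h, e]) := by
  subst e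
  rfl

theorem hypAt_hypBnd {n : ℤ} (ν : HypCh C (n + 1)) (s r p : ℤ) (h : p = n - r + s) :
    C.hypAt (hypBnd C n ν) s r p h =
      (C.d r).comp (C.hypAt ν s (r + 1) p (by rw [h]; ring))
      + esign r • (C.hypAt ν s r (p + 1) (by rw [h]; ring)).comp (C.dstarTo rfl)
      + esign (n + s) • (C.hypAt ν (s - 1) r p (by rw [h]; ring)
        + esign s • C.T r p (C.hypAt ν (s - 1) p r (by rw [h]; ring))) := by
  subst h
  rw [hypAt_rfl, hypBnd, cst_comp_T]
  simp only [hypAt, LinearMap.comp_assoc, dcst_comp_dstarTo]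

/-- The shift `θ ↦ ((-1)^{n+s+1} θ_{s+1})_s` raising the dimension by one. -/
def hypShift {n : ℤ} (θ : HypCh C n) : HypCh C (n + 1) := fun s r =>
  esign (n + s + 1) • C.hypAt θ (s + 1) r (n + 1 - r + s) (by ring)

theorem hypAt_hypShift {n : ℤ} (θ : HypCh C n) (s r p : ℤ) (h : p = n + 1 - r + s) :
    C.hypAt (C.hypShift θ) s r p h =
      esign (n + s + 1) • C.hypAt θ (s + 1) r p (by rw [h]; ring) := by
  subst h
  rfl

theorem hypBnd_hypShift {n : ℤ} (θ : HypCh C n) (hθ : IsHypStr C n θ) :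
    hypBnd C n (C.hypShift θ) = θ + θ := by
  funext s r
  have hc : C.hypAt (hypBnd C (n - 1) (hypCastDim C (show n = (n - 1) + 1 by ring) θ))
      (s + 1) r (n - r + s) (by ring) = 0 := by
    rw [show hypBnd C (n - 1) (hypCastDim C _ θ) = 0 from hθ]
    rfl
  simp only [hypAt_hypBnd, hypAt_hypCastDim, add_sub_cancel_right] at hc
  rw [← hypAt_rfl C (hypBnd C n (C.hypShift θ)), hypAt_hypBnd]
  simp only [hypAt_hypShift, sub_add_cancel, T_zsmul, LinearMap.smul_comp, comp_zsmul]
  rw [show n - 1 + (s + 1) = n + s by ring] at hc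
  rw [show n + (s - 1) + 1 = n + s by ring, Pi.add_apply, Pi.add_apply, ← hypAt_rfl C θ]
  simp only [esign_add _ 1, esign_one] at hc ⊢
  have hd := eq_neg_of_add_eq_zero_left hc
  rw [smul_comm (esign r), ← smul_add, hd]
  rcases esign_eq_one_or (n + s) with h | h <;> rw [h] <;> module

end ChainCx

theorem hypBnd_add (n : ℤ) (μ ν : HypCh C (n + 1)) :
    hypBnd C n (μ + ν) = hypBnd C n μ + hypBnd C n ν := by
  funext s r
  simp only [hypBnd, Pi.add_apply, ChainCx.T_add, LinearMap.add_comp, LinearMap.comp_add,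
    smul_add]
  abel

theorem exists_hypBnd_eq (h2 : IsUnit (2 : A)) (n : ℤ) (θ : HypCh C n) (hθ : IsHypStr C n θ) :
    ∃ ν : HypCh C (n + 1), hypBnd C n ν = θ := by
  choose ν hν using fun s r => exists_add_self_eq h2 (C.hypShift θ s r)
  have hb : hypBnd C n ν + hypBnd C n ν = θ + θ := by
    rw [← hypBnd_add, ← C.hypBnd_hypShift θ hθ]
    exact congrArg _ (funext fun s => funext fun r => hν s r)
  refine ⟨ν, funext fun s => funext fun r => LinearMap.ext fun x => eq_of_add_self_eq h2 ?_⟩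
  exact LinearMap.congr_fun (congrFun (congrFun hb s) r) x

/-- **Statement 8.** If `2` is invertible in the ring with involution `A`, then `Q̂^n(C) = 0`
for every finite-dimensional `A`-module chain complex `C` and every `n : ℤ`; that is, every
`n`-dimensional hyperquadratic structure on `C` is equivalent to `0`. -/
theorem stmt8 (A : Type) [Ring A] [StarRing A] (h2 : IsUnit (2 : A))
    (C : ChainCx A) (n : ℤ) :
    (∀ x : Qhyp C n, x = 0) ∧
    (∀ θ : HypCh C n, IsHypStr C n θ → ∃ ν : HypCh C (n + 1), hypBnd C n ν = θ) := by
  refine ⟨fun x => ?_, exists_hypBnd_eq C h2 n⟩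
  obtain ⟨⟨θ, hθ⟩, rfl⟩ := QuotientAddGroup.mk_surjective x
  refine (QuotientAddGroup.eq_zero_iff _).mpr ?_
  have hle : hypCycles C n ≤ hypBdrys C n :=
    (AddSubgroup.closure_le _).mpr fun θ hθ =>
      AddSubgroup.subset_closure (exists_hypBnd_eq C h2 n θ hθ)
  exact hle hθ
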